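/- Let d ≥ 6 and let a, b, c be natural numbers with a + b + c = d − 3. Then the function from pairs of 2×2 complex matrices to ℂ given by (A₀,A₁) ↦ Tr(A₁·A₀^a·A₁·A₀^b·A₁·A₀^c) lies in the linear span (inside the vector space of ℂ-valued functions on pairs of 2×2 matrices) of the set of functions {f_e : e ∈ {0,…,⌊(d−3)/2⌋}} ∪ {g_e : e ∈ {1,…,⌊(d−4)/2⌋}}, where f_e(A₀,A₁) = Tr(A₁²·A₀^e·A₁·A₀^{d−e−3}) and g_e(A₀,A₁) = Tr(A₁·A₀·A₁·A₀^e·A₁·A₀^{d−e−4}). -/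

import Mathlib

open Matrix

/-- Every power of a `2 × 2` matrix is a linear combination of the matrix and the identity. -/
theorem exists_pow_eq_smul_add_smul_one {R : Type*} [CommRing R] (X : Matrix (Fin 2) (Fin 2) R)
    (k : ℕ) : ∃ u v : R, X ^ k = u • X + v • 1 := by
  induction k with
  | zero => exact ⟨0, 1, by simp⟩
  | succ k ih =>
    obtain ⟨u, v, h⟩ := ih
    refine ⟨u * X.trace + v, -(u * X.det), ?_⟩
    have hX : X * X = X.trace • X - X.det • 1 := by
      ext i j
      fin_cases i <;> fin_cases j <;>
        simp [Matrix.mul_apply, Fin.sum_univ_two, trace_fin_two, det_fin_two] <;> ring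
    rw [pow_succ, h, add_mul, smul_mul_assoc, smul_mul_assoc, one_mul, hX]
    module

/-- The trace of the word `Y X ^ a Y X ^ b Y X ^ c`, as a function of the pair `(X, Y)`. -/
def weightThreeTrace {R : Type*} [CommRing R] (a b c : ℕ)
    (p : Matrix (Fin 2) (Fin 2) R × Matrix (Fin 2) (Fin 2) R) : R :=
  (p.2 * p.1 ^ a * p.2 * p.1 ^ b * p.2 * p.1 ^ c).trace

section

variable {R : Type*} [CommRing R]

theorem weightThreeTrace_rotate (a b c : ℕ) :
    weightThreeTrace (R := R) a b c = weightThreeTrace b c a := by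
  funext p
  simp only [weightThreeTrace, mul_assoc]
  rw [← mul_assoc p.2 (p.1 ^ a), trace_mul_comm]
  simp only [mul_assoc]

theorem weightThreeTrace_swap (a b c : ℕ) :
    weightThreeTrace (R := R) a b c = weightThreeTrace a c b := by
  funext ⟨X, Y⟩
  obtain ⟨b₁, b₀, hb⟩ := exists_pow_eq_smul_add_smul_one X b
  obtain ⟨c₁, c₀, hc⟩ := exists_pow_eq_smul_add_smul_one X c
  obtain ⟨a₁, a₀, ha⟩ := exists_pow_eq_smul_add_smul_one X a
  simp only [weightThreeTrace, ha, hb, hc]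
  rw [eta_fin_two X, eta_fin_two Y, one_fin_two]
  simp only [smul_of, smul_cons, smul_eq_mul, smul_empty, add_cons, of_add_of, mul_fin_two,
    trace_fin_two_of, head_cons, tail_cons, empty_add_empty]
  ring

theorem weightThreeTrace_succ (a b c : ℕ) :
    weightThreeTrace (R := R) (a + 1) b c =
      weightThreeTrace a (b + 1) c
        + (weightThreeTrace 0 (a + 1) (b + c) - weightThreeTrace 1 a (b + c))
        - (weightThreeTrace 0 (b + 1) (a + c) - weightThreeTrace 1 b (a + c)) := by
  funext ⟨X, Y⟩
  obtain ⟨b₁, b₀, hb⟩ := exists_pow_eq_smul_add_smul_one X b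
  obtain ⟨c₁, c₀, hc⟩ := exists_pow_eq_smul_add_smul_one X c
  obtain ⟨a₁, a₀, ha⟩ := exists_pow_eq_smul_add_smul_one X a
  simp only [weightThreeTrace, Pi.add_apply, Pi.sub_apply, pow_add, pow_one, pow_zero, ha, hb, hc]
  rw [eta_fin_two X, eta_fin_two Y, one_fin_two]
  simp only [smul_of, smul_cons, smul_eq_mul, smul_empty, add_cons, of_add_of, mul_fin_two,
    trace_fin_two_of, head_cons, tail_cons, empty_add_empty]
  ring

/-- A submodule containing the words with a factor `Y Y` or `Y X Y` contains all words of weight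
three and the same degree. -/
theorem weightThreeTrace_mem
    {S : Submodule R (Matrix (Fin 2) (Fin 2) R × Matrix (Fin 2) (Fin 2) R → R)} {n : ℕ}
    (h₀ : ∀ b c, b + c = n → weightThreeTrace 0 b c ∈ S)
    (h₁ : ∀ b c, 1 + b + c = n → weightThreeTrace 1 b c ∈ S)
    (a b c : ℕ) (h : a + b + c = n) : weightThreeTrace a b c ∈ S := by
  induction a generalizing b with
  | zero => exact h₀ b c (by lia)
  | succ a ih =>
    rw [weightThreeTrace_succ]
    exact S.sub_mem (S.add_mem (ih _ (by lia)) (S.sub_mem (h₀ _ _ (by lia)) (h₁ _ _ (by lia))))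
      (S.sub_mem (h₀ _ _ (by lia)) (h₁ _ _ (by lia)))

end

/-- Every weight-3 trace function `(A₀,A₁) ↦ Tr(A₁ A₀^a A₁ A₀^b A₁ A₀^c)` with
`a + b + c = d - 3` lies in the span of the functions corresponding to bracelets
containing `11` or `101`. -/
theorem weight_three_spanning (d a b c : ℕ) (hd : 6 ≤ d) (habc : a + b + c = d - 3) :
    (fun p : Matrix (Fin 2) (Fin 2) ℂ × Matrix (Fin 2) (Fin 2) ℂ =>
        (p.2 * p.1 ^ a * p.2 * p.1 ^ b * p.2 * p.1 ^ c).trace)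
      ∈ Submodule.span ℂ
        ({f | ∃ e ≤ (d - 3) / 2,
            f = fun p : Matrix (Fin 2) (Fin 2) ℂ × Matrix (Fin 2) (Fin 2) ℂ =>
              (p.2 * p.2 * p.1 ^ e * p.2 * p.1 ^ (d - e - 3)).trace}
          ∪ {f | ∃ e, 1 ≤ e ∧ e ≤ (d - 4) / 2 ∧
            f = fun p : Matrix (Fin 2) (Fin 2) ℂ × Matrix (Fin 2) (Fin 2) ℂ =>
              (p.2 * p.1 * p.2 * p.1 ^ e * p.2 * p.1 ^ (d - e - 4)).trace}) := by
  set S : Submodule ℂ (Matrix (Fin 2) (Fin 2) ℂ × Matrix (Fin 2) (Fin 2) ℂ → ℂ) :=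
    Submodule.span ℂ _
  have h₀_le (b c : ℕ) (h : b + c = d - 3) (hbc : b ≤ c) : weightThreeTrace 0 b c ∈ S := by
    refine Submodule.subset_span (Or.inl ⟨b, by lia, ?_⟩)
    obtain rfl : c = d - b - 3 := by lia
    funext p
    simp [weightThreeTrace]
  have h₀ (b c : ℕ) (h : b + c = d - 3) : weightThreeTrace 0 b c ∈ S := by
    rcases le_total b c with hbc | hbc
    · exact h₀_le b c h hbc
    · rw [weightThreeTrace_swap]
      exact h₀_le c b (by lia) hbc
  have h₁_le (b c : ℕ) (h : 1 + b + c = d - 3) (hbc : b ≤ c) : weightThreeTrace 1 b c ∈ S := by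
    rcases b.eq_zero_or_pos with rfl | hb
    · rw [weightThreeTrace_rotate]
      exact h₀ c 1 (by lia)
    · refine Submodule.subset_span (Or.inr ⟨b, hb, by lia, ?_⟩)
      obtain rfl : c = d - b - 4 := by lia
      funext p
      simp [weightThreeTrace]
  have h₁ (b c : ℕ) (h : 1 + b + c = d - 3) : weightThreeTrace 1 b c ∈ S := by
    rcases le_total b c with hbc | hbc
    · exact h₁_le b c h hbc
    · rw [weightThreeTrace_swap]
      exact h₁_le c b (by lia) hbc
  exact weightThreeTrace_mem h₀ h₁ a b c habc
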